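/- arXiv:1810.08099 — 9 statements merged into one kernel-verified Lean document; each statement's English description precedes it below -/
import Mathlib

section
/- Let B be a nonzero 3×3 complex matrix with B² = 0 and rank(B) = 1. Then H(B) ≠ 0 and F(B) = 1/2. (Since these conditions are invariant under B ↦ c·g·B·g⁻¹, this proves that F is identically 1/2 on the set of all closed G₂-structures on the nilpotent Lie group S_{μ₂}.) -/
open Matrix

/-- Hermitian part `H(B) = (1/2)(B + Bᴴ)`. -/
noncomputable def hermPart (B : Matrix (Fin 3) (Fin 3) ℂ) : Matrix (Fin 3) (Fin 3) ℂ :=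
  (1 / 2 : ℂ) • (B + Bᴴ)

/-- Squared Frobenius norm `|M|² = Re (tr (M Mᴴ))`. -/
noncomputable def frobSq (M : Matrix (Fin 3) (Fin 3) ℂ) : ℝ :=
  (Matrix.trace (M * Mᴴ)).re

/-- The Ricci-pinching functional
`F(B) = |H(B)|⁴ / (|H(B)|⁴ + (1/8)|[B,Bᴴ]|²)`. -/
noncomputable def Fpinch (B : Matrix (Fin 3) (Fin 3) ℂ) : ℝ :=
  (frobSq (hermPart B)) ^ 2 /
    ((frobSq (hermPart B)) ^ 2 + (1 / 8) * frobSq (B * Bᴴ - Bᴴ * B))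

lemma rank_one_aux (B : Matrix (Fin 3) (Fin 3) ℂ) (hrk : B.rank = 1) :
    ∃ u v : Fin 3 → ℂ, B = vecMulVec u v := by
  unfold Matrix.rank at hrk
  obtain ⟨u, -, hu⟩ := finrank_eq_one_iff'.1 hrk
  choose c hc using fun j : Fin 3 => hu ⟨B.mulVecLin (Pi.single j 1), LinearMap.mem_range_self _ _⟩
  refine ⟨u.1, c, ?_⟩
  ext i j
  have h := congrFun (congrArg Subtype.val (hc j)) i
  simp at h
  rw [vecMulVec_apply, mul_comm]
  exact h.symm

lemma triple_aux (B : Matrix (Fin 3) (Fin 3) ℂ) (hrk : B.rank = 1) :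
    B * Bᴴ * B = (B * Bᴴ).trace • B := by
  obtain ⟨u, v, rfl⟩ := rank_one_aux B hrk
  ext i j
  simp [Matrix.mul_apply, Matrix.trace, Fin.sum_univ_three, vecMulVec_apply]
  ring

theorem F_eq_half_of_sq_zero_rank_one (B : Matrix (Fin 3) (Fin 3) ℂ)
    (hB : B ≠ 0) (hsq : B * B = 0) (hrk : B.rank = 1) :
    hermPart B ≠ 0 ∧ Fpinch B = 1 / 2 := by
  have h3 := triple_aux B hrk
  have hsq' : Bᴴ * Bᴴ = 0 := by rw [← conjTranspose_mul, hsq, conjTranspose_zero]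
  set t : ℂ := (B * Bᴴ).trace with ht
  open scoped ComplexOrder in
  have htne : t ≠ 0 := fun h => hB (trace_mul_conjTranspose_self_eq_zero_iff.1 h)
  have htstar : star t = t := by
    rw [ht, ← trace_conjTranspose, conjTranspose_mul, conjTranspose_conjTranspose]
  have htre : ((t.re : ℝ) : ℂ) = t := Complex.conj_eq_iff_re.1 htstar
  have hre : t.re ≠ 0 := fun h => htne (by rw [← htre, h]; simp)
  have htc : (Bᴴ * B).trace = t := by rw [trace_mul_comm]
  have hH : frobSq (hermPart B) = t.re / 2 := by
    have : (hermPart B * (hermPart B)ᴴ).trace = t / 2 := by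
      simp [hermPart, mul_add, add_mul, hsq, hsq', htc, ← ht]
      ring
    rw [frobSq, this, ← htre]
    norm_cast
  have hC : frobSq (B * Bᴴ - Bᴴ * B) = 2 * t.re ^ 2 := by
    have e1 : (B * Bᴴ) * (B * Bᴴ) = t • (B * Bᴴ) := by
      rw [← Matrix.mul_assoc, h3, Matrix.smul_mul]
    have e2 : (Bᴴ * B) * (Bᴴ * B) = t • (Bᴴ * B) := by
      rw [Matrix.mul_assoc, ← Matrix.mul_assoc B, h3, Matrix.mul_smul]
    have e3 : (B * Bᴴ) * (Bᴴ * B) = 0 := by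
      rw [Matrix.mul_assoc, ← Matrix.mul_assoc Bᴴ, hsq']; simp
    have e4 : (Bᴴ * B) * (B * Bᴴ) = 0 := by
      rw [Matrix.mul_assoc, ← Matrix.mul_assoc B, hsq]; simp
    have : ((B * Bᴴ - Bᴴ * B) * (B * Bᴴ - Bᴴ * B)ᴴ).trace = 2 * t ^ 2 := by
      rw [conjTranspose_sub, conjTranspose_mul, conjTranspose_mul, conjTranspose_conjTranspose,
        sub_mul, mul_sub, mul_sub, e1, e2, e3, e4]
      simp [htc, ← ht]
      ring
    rw [frobSq, this, ← htre]
    norm_cast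
  constructor
  · intro h
    rw [h] at hH
    simp [frobSq] at hH
    exact hre (by linarith)
  · rw [Fpinch, hH, hC]
    field_simp
    norm_num
end

section
/- For every real number a, the 3×3 complex matrix A_a := a·E₁₂ + E₂₃ satisfies H(A_a) ≠ 0 and F(A_a) = (a⁴ + 2a² + 1)/(2a⁴ + a² + 2). (These matrices parameterize a curve of closed G₂-structures on the 3-step nilpotent Lie group S_{μ₆}.) -/
open Matrix

/-- The matrix `A_a = a·E₁₂ + E₂₃` parameterizing a curve of closed
G₂-structures on the nilpotent Lie group `S_{μ₆}`. -/
noncomputable def Acurve (a : ℝ) : Matrix (Fin 3) (Fin 3) ℂ :=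
  Matrix.single 0 1 (a : ℂ) + Matrix.single 1 2 1

theorem Acurve_eq (a : ℝ) : Acurve a = !![0, (a : ℂ), 0; 0, 0, 1; 0, 0, 0] := by
  ext i j
  fin_cases i <;> fin_cases j <;> simp [Acurve, Matrix.single]

theorem frobSq_herm (a : ℝ) : frobSq (hermPart (Acurve a)) = (a ^ 2 + 1) / 2 := by
  rw [Acurve_eq]
  simp [frobSq, hermPart, Matrix.trace, Fin.sum_univ_three, Matrix.mul_apply]
  ring

theorem frobSq_comm (a : ℝ) :
    frobSq (Acurve a * (Acurve a)ᴴ - (Acurve a)ᴴ * Acurve a) = 2 * a ^ 4 - 2 * a ^ 2 + 2 := by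
  rw [Acurve_eq]
  simp [frobSq, Matrix.trace, Fin.sum_univ_three, Matrix.mul_apply, -Matrix.cons_mul]
  ring

theorem F_on_mu6_curve (a : ℝ) :
    hermPart (Acurve a) ≠ 0 ∧
      Fpinch (Acurve a) = (a ^ 4 + 2 * a ^ 2 + 1) / (2 * a ^ 4 + a ^ 2 + 2) := by
  constructor
  · intro h
    have h1 := frobSq_herm a
    rw [h] at h1
    simp [frobSq] at h1
    nlinarith [sq_nonneg a]
  · unfold Fpinch
    rw [frobSq_herm, frobSq_comm]
    have h1 : (2 * a ^ 4 + a ^ 2 + 2) ≠ 0 := by positivity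
    have h2 : ((a ^ 2 + 1) / 2) ^ 2 + 1 / 8 * (2 * a ^ 4 - 2 * a ^ 2 + 2)
        = (2 * a ^ 4 + a ^ 2 + 2) / 4 := by ring
    rw [h2]
    field_simp
    ring
end

section
/- For every real t ≠ 0, the 3×3 complex matrix A_t := t·E₁₁ − t·E₂₂ − E₁₂ + E₂₁ satisfies H(A_t) ≠ 0 and F(A_t) = t⁴/(t⁴ + t²); consequently F(A_t) tends to 0 as t tends to 0 (t ≠ 0). -/
open Matrix

/-- The matrix `A_t = t·E₁₁ − t·E₂₂ − E₁₂ + E₂₁`. -/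
noncomputable def Afam (t : ℝ) : Matrix (Fin 3) (Fin 3) ℂ :=
  Matrix.single 0 0 (t : ℂ) - Matrix.single 1 1 (t : ℂ)
    - Matrix.single 0 1 1 + Matrix.single 1 0 1

theorem Afam_eq (t : ℝ) : Afam t = !![(t:ℂ), -1, 0; 1, -(t:ℂ), 0; 0, 0, 0] := by
  ext i j
  fin_cases i <;> fin_cases j <;> simp [Afam, Matrix.single]

theorem Afam_conj (t : ℝ) : (Afam t)ᴴ = !![(t:ℂ), 1, 0; -1, -(t:ℂ), 0; 0, 0, 0] := by
  rw [Afam_eq]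
  ext i j
  fin_cases i <;> fin_cases j <;> simp [Matrix.conjTranspose_apply]

theorem herm_Afam (t : ℝ) :
    hermPart (Afam t) = !![(t:ℂ), 0, 0; 0, -(t:ℂ), 0; 0, 0, 0] := by
  rw [hermPart, Afam_conj, Afam_eq]
  ext i j
  fin_cases i <;> fin_cases j <;> simp <;> ring

theorem comm_Afam (t : ℝ) :
    Afam t * (Afam t)ᴴ - (Afam t)ᴴ * Afam t
      = !![0, 4 * (t:ℂ), 0; 4 * (t:ℂ), 0, 0; 0, 0, 0] := by
  rw [Afam_conj, Afam_eq]
  ext i j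
  fin_cases i <;> fin_cases j <;> simp [Matrix.mul_apply, Fin.sum_univ_three] <;> ring

theorem Fpinch_Afam (t : ℝ) (ht : t ≠ 0) : Fpinch (Afam t) = t ^ 4 / (t ^ 4 + t ^ 2) := by
  have h1 : frobSq (hermPart (Afam t)) = 2 * t ^ 2 := by
    rw [herm_Afam]
    simp only [frobSq, Matrix.trace, Matrix.diag_apply, Matrix.mul_apply, Fin.sum_univ_three,
      Matrix.conjTranspose_apply]
    simp
    ring
  have h2 : frobSq (Afam t * (Afam t)ᴴ - (Afam t)ᴴ * Afam t) = 32 * t ^ 2 := by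
    rw [comm_Afam]
    simp only [frobSq, Matrix.trace, Matrix.diag_apply, Matrix.mul_apply, Fin.sum_univ_three,
      Matrix.conjTranspose_apply]
    simp
    ring
  rw [Fpinch, h1, h2]
  have : t ^ 4 + t ^ 2 ≠ 0 := by positivity
  rw [div_eq_div_iff (by positivity) this]
  ring

theorem F_Afam :
    (∀ t : ℝ, t ≠ 0 →
      hermPart (Afam t) ≠ 0 ∧ Fpinch (Afam t) = t ^ 4 / (t ^ 4 + t ^ 2)) ∧
    Filter.Tendsto (fun t : ℝ => Fpinch (Afam t))
      (nhdsWithin 0 {0}ᶜ) (nhds 0) := by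
  refine ⟨fun t ht => ⟨fun h => ?_, Fpinch_Afam t ht⟩, ?_⟩
  · rw [herm_Afam] at h
    have := congrFun (congrFun h 0) 0
    simp at this
    exact ht this
  · have hc : Filter.Tendsto (fun t : ℝ => t ^ 2 / (t ^ 2 + 1)) (nhds 0) (nhds 0) := by
      have : Continuous (fun t : ℝ => t ^ 2 / (t ^ 2 + 1)) :=
        Continuous.div (by fun_prop) (by fun_prop) (fun t => by positivity)
      simpa using this.tendsto 0
    refine (hc.mono_left nhdsWithin_le_nhds).congr' ?_
    filter_upwards [self_mem_nhdsWithin] with t ht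
    have ht : t ≠ 0 := ht
    rw [Fpinch_Afam t ht, div_eq_div_iff (by positivity) (by positivity)]
    ring
end

section
/- For every real t, the 3×3 complex matrix B_t := t·E₁₁ + t·E₂₂ − 2t·E₃₃ − E₁₂ + E₂₁ is normal, i.e., B_t·B_tᴴ = B_tᴴ·B_t; consequently, for every t ≠ 0 one has H(B_t) ≠ 0 and F(B_t) = 1. -/
open Matrix

/-- The matrix `B_t = t·E₁₁ + t·E₂₂ − 2t·E₃₃ − E₁₂ + E₂₁`. -/
noncomputable def Bfam (t : ℝ) : Matrix (Fin 3) (Fin 3) ℂ :=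
  Matrix.single 0 0 (t : ℂ) + Matrix.single 1 1 (t : ℂ)
    - Matrix.single 2 2 (2 * t : ℂ)
    - Matrix.single 0 1 1 + Matrix.single 1 0 1

theorem Bfam_eq_explicit (t : ℝ) :
    Bfam t = !![(t:ℂ), -1, 0; 1, (t:ℂ), 0; 0, 0, -(2 * t : ℂ)] := by
  ext i j
  fin_cases i <;> fin_cases j <;> simp [Bfam, Matrix.single]

theorem Bfam_conj (t : ℝ) :
    (Bfam t)ᴴ = !![(t:ℂ), 1, 0; -1, (t:ℂ), 0; 0, 0, -(2 * t : ℂ)] := by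
  rw [Bfam_eq_explicit]
  ext i j
  fin_cases i <;> fin_cases j <;> simp [Matrix.conjTranspose_apply]

theorem Bfam_normal_aux (t : ℝ) : Bfam t * (Bfam t)ᴴ = (Bfam t)ᴴ * Bfam t := by
  rw [Bfam_conj, Bfam_eq_explicit]
  ext i j
  fin_cases i <;> fin_cases j <;> simp [Matrix.mul_apply, Fin.sum_univ_three]

theorem Bfam_herm (t : ℝ) :
    hermPart (Bfam t) = !![(t:ℂ), 0, 0; 0, (t:ℂ), 0; 0, 0, -(2 * t : ℂ)] := by
  rw [hermPart, Bfam_conj, Bfam_eq_explicit]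
  ext i j
  fin_cases i <;> fin_cases j <;> simp <;> ring

theorem Bfam_frob (t : ℝ) : frobSq (hermPart (Bfam t)) = 6 * t ^ 2 := by
  rw [Bfam_herm, frobSq]
  simp only [Matrix.trace, Matrix.diag_apply, Fin.sum_univ_three, Matrix.mul_apply, Matrix.conjTranspose_apply]
  simp
  ring

theorem Bfam_normal_F_eq_one :
    (∀ t : ℝ, Bfam t * (Bfam t)ᴴ = (Bfam t)ᴴ * Bfam t) ∧
    (∀ t : ℝ, t ≠ 0 → hermPart (Bfam t) ≠ 0 ∧ Fpinch (Bfam t) = 1) := by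
  refine ⟨Bfam_normal_aux, fun t ht => ⟨fun h => ?_, ?_⟩⟩
  · have h1 := congrFun (congrFun h 0) 0
    rw [Bfam_herm] at h1
    simp at h1
    exact ht h1
  · have h0 : frobSq (0 : Matrix (Fin 3) (Fin 3) ℂ) = 0 := by simp [frobSq]
    rw [Fpinch, Bfam_normal_aux, sub_self, h0, Bfam_frob, mul_zero, add_zero]
    exact div_self (by positivity)
end

section
/- For every real t, the eigenvalues of the 3×3 complex matrix B_t := t·E₁₁ + t·E₂₂ − 2t·E₃₃ − E₁₂ + E₂₁ are exactly t+i, t−i and −2t. Moreover, for all real numbers 0 < t < s there exist no nonzero real number c and no invertible g ∈ M₃(ℂ) such that B_s = c·(g·B_t·g⁻¹); in particular, the Lie algebras μ_{B_t}, t > 0, are pairwise non-isomorphic. -/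
open Matrix

lemma det_Bfam_aux (t : ℝ) (z c : ℂ) :
    (z • (1 : Matrix (Fin 3) (Fin 3) ℂ) - c • Bfam t).det
      = (z - c * (t + Complex.I)) * (z - c * (t - Complex.I)) * (z + 2 * c * t) := by
  have hI := Complex.I_mul_I
  rw [Matrix.det_fin_three]
  simp [Bfam, Matrix.single_apply, Matrix.one_apply]
  linear_combination (-c ^ 2 * (z + 2 * c * t)) * (-hI)

theorem spectrum_Bfam_and_nonconjugate :
    (∀ t : ℝ, spectrum ℂ (Bfam t) =
      {(t : ℂ) + Complex.I, (t : ℂ) - Complex.I, -2 * (t : ℂ)}) ∧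
    (∀ t s : ℝ, 0 < t → t < s →
      ∀ c : ℝ, c ≠ 0 → ∀ g : Matrix (Fin 3) (Fin 3) ℂ, IsUnit g →
        Bfam s ≠ (c : ℂ) • (g * Bfam t * g⁻¹)) := by
  constructor
  · intro t
    ext z
    have h := det_Bfam_aux t z 1
    rw [spectrum.mem_iff, Matrix.isUnit_iff_isUnit_det, isUnit_iff_ne_zero, not_not,
      Algebra.algebraMap_eq_smul_one]
    rw [one_smul] at h
    rw [h]
    simp only [Set.mem_insert_iff, Set.mem_singleton_iff, mul_eq_zero, one_mul, mul_one]
    rw [sub_eq_zero, sub_eq_zero, or_assoc, neg_mul, eq_neg_iff_add_eq_zero]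
  · intro t s ht hs c hc g hg h
    have hg' : IsUnit g.det := (Matrix.isUnit_iff_isUnit_det g).1 hg
    have h1 := det_Bfam_aux s (s + Complex.I) 1
    have h2 := det_Bfam_aux t (s + Complex.I) c
    have h3 : ((s : ℂ) + Complex.I) • (1 : Matrix (Fin 3) (Fin 3) ℂ) - (1 : ℂ) • Bfam s
        = g * (((s : ℂ) + Complex.I) • (1 : Matrix (Fin 3) (Fin 3) ℂ) - (c : ℂ) • Bfam t)
          * g⁻¹ := by
      rw [h]
      simp [mul_sub, sub_mul, Matrix.mul_nonsing_inv g hg']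
    rw [h3, Matrix.det_conj hg, h2] at h1
    have h4 : ((s : ℂ) + Complex.I - c * (t + Complex.I)) * (s + Complex.I - c * (t - Complex.I))
        * (s + Complex.I + 2 * c * t) = 0 := by rw [h1]; ring
    rcases mul_eq_zero.1 h4 with h5 | h5
    · rcases mul_eq_zero.1 h5 with h6 | h6
      · have hr := congrArg Complex.re h6
        have hi := congrArg Complex.im h6
        simp at hr hi
        have : c = 1 := by linarith
        subst this
        linarith
      · have hr := congrArg Complex.re h6
        have hi := congrArg Complex.im h6
        simp at hr hi
        have : c = -1 := by linarith
        subst this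
        linarith
    · have hi := congrArg Complex.im h5
      simp at hi
end

section
/- For every real t ≠ 0, the 3×3 complex matrix C_t := t·E₁₁ − E₁₂ + E₂₁ − t·E₃₃ satisfies H(C_t) ≠ 0 and F(C_t) = 4t⁴/(4t⁴ + t²); consequently F(C_t) tends to 0 as t tends to 0 from the right. -/
open Matrix

/-- The matrix `C_t = t·E₁₁ − E₁₂ + E₂₁ − t·E₃₃`. -/
noncomputable def Cfam (t : ℝ) : Matrix (Fin 3) (Fin 3) ℂ :=
  Matrix.single 0 0 (t : ℂ) - Matrix.single 0 1 1
    + Matrix.single 1 0 1 - Matrix.single 2 2 (t : ℂ)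

theorem Cfam_eq (t : ℝ) : Cfam t = !![(t : ℂ), -1, 0; 1, 0, 0; 0, 0, -(t : ℂ)] := by
  ext i j
  fin_cases i <;> fin_cases j <;> simp [Cfam, Matrix.single_apply]

theorem Cfam_conj (t : ℝ) : (Cfam t)ᴴ = !![(t : ℂ), 1, 0; -1, 0, 0; 0, 0, -(t : ℂ)] := by
  rw [Cfam_eq]
  ext i j
  fin_cases i <;> fin_cases j <;> simp [Matrix.conjTranspose_apply]

theorem herm_Cfam (t : ℝ) :
    hermPart (Cfam t) = !![(t : ℂ), 0, 0; 0, 0, 0; 0, 0, -(t : ℂ)] := by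
  rw [hermPart, Cfam_conj, Cfam_eq]
  ext i j
  fin_cases i <;> fin_cases j <;> simp <;> ring

theorem comm_Cfam (t : ℝ) : Cfam t * (Cfam t)ᴴ - (Cfam t)ᴴ * Cfam t
    = !![0, 2 * (t : ℂ), 0; 2 * (t : ℂ), 0, 0; 0, 0, 0] := by
  rw [Cfam_conj, Cfam_eq]
  ext i j
  fin_cases i <;> fin_cases j <;> simp [Matrix.mul_apply, Fin.sum_univ_three] <;> ring

theorem Fpinch_Cfam (t : ℝ) : Fpinch (Cfam t) = 4 * t ^ 4 / (4 * t ^ 4 + t ^ 2) := by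
  have h1 : frobSq (hermPart (Cfam t)) = 2 * t ^ 2 := by
    rw [herm_Cfam]
    simp only [frobSq, Matrix.trace, Matrix.diag_apply, Fin.sum_univ_three, Matrix.mul_apply, Matrix.conjTranspose_apply]
    simp
    ring
  have h2 : frobSq (Cfam t * (Cfam t)ᴴ - (Cfam t)ᴴ * Cfam t) = 8 * t ^ 2 := by
    rw [comm_Cfam]
    simp only [frobSq, Matrix.trace, Matrix.diag_apply, Fin.sum_univ_three, Matrix.mul_apply, Matrix.conjTranspose_apply]
    simp
    ring
  rw [Fpinch, h1, h2]
  congr 1 <;> ring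

theorem F_Cfam :
    (∀ t : ℝ, t ≠ 0 →
      hermPart (Cfam t) ≠ 0 ∧
        Fpinch (Cfam t) = 4 * t ^ 4 / (4 * t ^ 4 + t ^ 2)) ∧
    Filter.Tendsto (fun t : ℝ => Fpinch (Cfam t))
      (nhdsWithin 0 (Set.Ioi 0)) (nhds 0) := by
  refine ⟨fun t ht => ⟨fun h => ht ?_, Fpinch_Cfam t⟩, ?_⟩
  · rw [herm_Cfam] at h
    have := congrFun (congrFun h 0) 0
    simpa using this
  · have hc : Filter.Tendsto (fun t : ℝ => 4 * t ^ 2 / (4 * t ^ 2 + 1))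
        (nhdsWithin 0 (Set.Ioi 0)) (nhds 0) := by
      have hcont : Continuous (fun t : ℝ => 4 * t ^ 2 / (4 * t ^ 2 + 1)) :=
        Continuous.div (by fun_prop) (by fun_prop) (fun t => by positivity)
      have := hcont.tendsto 0
      simp only [ne_eq, OfNat.ofNat_ne_zero, not_false_eq_true, zero_pow, mul_zero, zero_div] at this
      exact this.mono_left nhdsWithin_le_nhds
    refine hc.congr' ?_
    filter_upwards [self_mem_nhdsWithin] with t ht
    have ht0 : 0 < t := ht
    rw [Fpinch_Cfam, div_eq_div_iff (by positivity) (by positivity)]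
    ring
end

section
/- Fix real numbers a, b, c with a ≠ b, and for real t let D_t be the 3×3 complex matrix with diagonal (ai, bi, ci) and with t in entry (1,2) and all other off-diagonal entries 0, i.e., D_t := ai·E₁₁ + bi·E₂₂ + ci·E₃₃ + t·E₁₂. Then H(D_t) ≠ 0 for every t ≠ 0, and F(D_t) tends to 0 as t tends to 0 (t ≠ 0). -/
open Matrix

/-- The matrix `D_t = ai·E₁₁ + bi·E₂₂ + ci·E₃₃ + t·E₁₂`. -/
noncomputable def Dfam (a b c t : ℝ) : Matrix (Fin 3) (Fin 3) ℂ :=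
  Matrix.single 0 0 ((a : ℂ) * Complex.I)
    + Matrix.single 1 1 ((b : ℂ) * Complex.I)
    + Matrix.single 2 2 ((c : ℂ) * Complex.I)
    + Matrix.single 0 1 (t : ℂ)

theorem Dfam_eq (a b c t : ℝ) : Dfam a b c t =
    !![(a : ℂ) * Complex.I, (t : ℂ), 0; 0, (b : ℂ) * Complex.I, 0; 0, 0, (c : ℂ) * Complex.I] := by
  ext i j
  fin_cases i <;> fin_cases j <;> simp [Dfam, Matrix.single]

theorem frob_herm (a b c t : ℝ) : frobSq (hermPart (Dfam a b c t)) = t ^ 2 / 2 := by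
  rw [Dfam_eq]
  simp [frobSq, hermPart, Matrix.trace, Fin.sum_univ_three, Matrix.mul_apply,
    Matrix.conjTranspose_apply]
  ring

theorem frob_comm (a b c t : ℝ) :
    frobSq (Dfam a b c t * (Dfam a b c t)ᴴ - (Dfam a b c t)ᴴ * Dfam a b c t)
      = 2 * t ^ 4 + 2 * t ^ 2 * (a - b) ^ 2 := by
  rw [Dfam_eq]
  simp only [frobSq, Matrix.trace, Matrix.diag_apply, Fin.sum_univ_three, Matrix.mul_apply,
    Matrix.conjTranspose_apply, Matrix.sub_apply]
  simp
  ring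

theorem Fpinch_Dfam (a b c t : ℝ) (hab : a ≠ b) :
    Fpinch (Dfam a b c t) = t ^ 2 / (2 * t ^ 2 + (a - b) ^ 2) := by
  have h : 0 < (a - b) ^ 2 := by
    have := sub_ne_zero.mpr hab
    positivity
  rw [Fpinch, frob_herm, frob_comm]
  rcases eq_or_ne t 0 with rfl | ht
  · simp
  · have h2 : 0 < t ^ 2 := by positivity
    rw [div_eq_div_iff (by positivity) (by positivity)]
    ring

theorem F_Dfam (a b c : ℝ) (hab : a ≠ b) :
    (∀ t : ℝ, t ≠ 0 → hermPart (Dfam a b c t) ≠ 0) ∧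
    Filter.Tendsto (fun t : ℝ => Fpinch (Dfam a b c t))
      (nhdsWithin 0 {0}ᶜ) (nhds 0) := by
  refine ⟨fun t ht h => ?_, ?_⟩
  · have h1 := frob_herm a b c t
    rw [h] at h1
    have h0 : frobSq 0 = 0 := by simp [frobSq]
    rw [h0] at h1
    have : 0 < t ^ 2 := by positivity
    linarith
  · have hne : 2 * (0 : ℝ) ^ 2 + (a - b) ^ 2 ≠ 0 := by
      have := sub_ne_zero.mpr hab
      positivity
    simp only [Fpinch_Dfam a b c _ hab]
    have hc : ContinuousAt (fun t : ℝ => t ^ 2 / (2 * t ^ 2 + (a - b) ^ 2)) 0 :=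
      ContinuousAt.div (by fun_prop) (by fun_prop) hne
    have := hc.tendsto
    simp only [ne_eq, OfNat.ofNat_ne_zero, not_false_eq_true, zero_pow, zero_div] at this
    exact this.mono_left nhdsWithin_le_nhds
end

section
/- For all real numbers a, b with a + b ≠ 0, the 3×3 complex matrix A := a·E₁₂ + b·E₂₁ satisfies H(A) ≠ 0 and F(A) = (a+b)⁴ / ((a+b)⁴ + (a²−b²)²). -/
open Matrix

lemma ab_eq (a b : ℝ) : (Matrix.single 0 1 (a : ℂ) + Matrix.single 1 0 (b : ℂ) : Matrix (Fin 3) (Fin 3) ℂ)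
    = !![0, (a : ℂ), 0; (b : ℂ), 0, 0; 0, 0, 0] := by
  ext i j
  fin_cases i <;> fin_cases j <;> simp [Matrix.single]

lemma ab_conj (a b : ℝ) : (!![0, (a : ℂ), 0; (b : ℂ), 0, 0; 0, 0, 0])ᴴ
    = !![0, (b : ℂ), 0; (a : ℂ), 0, 0; 0, 0, 0] := by
  ext i j
  fin_cases i <;> fin_cases j <;> simp [Matrix.conjTranspose_apply]

lemma ab_herm (a b : ℝ) : hermPart (!![0, (a : ℂ), 0; (b : ℂ), 0, 0; 0, 0, 0])
    = !![0, (((a + b) / 2 : ℝ) : ℂ), 0; (((a + b) / 2 : ℝ) : ℂ), 0, 0; 0, 0, 0] := by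
  unfold hermPart
  rw [ab_conj]
  ext i j
  fin_cases i <;> fin_cases j <;> simp <;> ring

lemma ab_frob (c d : ℝ) : frobSq (!![0, (c : ℂ), 0; (d : ℂ), 0, 0; 0, 0, 0]) = c ^ 2 + d ^ 2 := by
  unfold frobSq
  rw [ab_conj]
  simp [Matrix.trace, Fin.sum_univ_three, Matrix.mul_apply]
  ring

lemma ab_comm (a b : ℝ) : frobSq (!![0, (a : ℂ), 0; (b : ℂ), 0, 0; 0, 0, 0]
      * !![0, (b : ℂ), 0; (a : ℂ), 0, 0; 0, 0, 0]
      - !![0, (b : ℂ), 0; (a : ℂ), 0, 0; 0, 0, 0]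
      * !![0, (a : ℂ), 0; (b : ℂ), 0, 0; 0, 0, 0]) = 2 * (a ^ 2 - b ^ 2) ^ 2 := by
  unfold frobSq
  simp only [Matrix.trace, Matrix.diag_apply, Fin.sum_univ_three, Matrix.mul_apply,
    Matrix.conjTranspose_apply, Matrix.sub_apply]
  simp
  ring

theorem F_ab_family (a b : ℝ) (hab : a + b ≠ 0) :
    hermPart (Matrix.single 0 1 (a : ℂ)
        + Matrix.single 1 0 (b : ℂ)) ≠ 0 ∧
    Fpinch (Matrix.single 0 1 (a : ℂ)
        + Matrix.single 1 0 (b : ℂ)) =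
      (a + b) ^ 4 / ((a + b) ^ 4 + (a ^ 2 - b ^ 2) ^ 2) := by
  rw [ab_eq]
  constructor
  · rw [ab_herm]
    intro h
    have h1 := congrFun (congrFun h 0) 1
    have h2 : (((a + b) / 2 : ℝ) : ℂ) = 0 := by simpa using h1
    have h3 : (a + b) / 2 = 0 := by exact_mod_cast h2
    exact hab (by linarith)
  · unfold Fpinch
    rw [ab_herm, ab_frob, ab_conj, ab_comm]
    have e1 : (((a + b) / 2) ^ 2 + ((a + b) / 2) ^ 2) ^ 2 = (a + b) ^ 4 / 4 := by ring
    have e2 : (a + b) ^ 4 / 4 + 1 / 8 * (2 * (a ^ 2 - b ^ 2) ^ 2)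
        = ((a + b) ^ 4 + (a ^ 2 - b ^ 2) ^ 2) / 4 := by ring
    rw [e1, e2, div_div_div_cancel_right₀ (by norm_num)]
end

section
/- Let A be an n×n complex matrix and let A = S + N be a decomposition with S diagonalizable (over ℂ), N nilpotent and S·N = N·S. Then both S and N lie in the closure (with respect to the standard topology on n×n complex matrices) of the set { c·(g·A·g⁻¹) : c ∈ ℝ, c ≠ 0, g ∈ M_n(ℂ) invertible }. -/
open Matrix

theorem aux_scale {R : Type*} [CommRing R] (u : R) (hu : IsUnit u) (k : ℕ) :
    ∀ (M : Type) [AddCommGroup M] [Module R M] [IsSemisimpleModule R M]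
      (N : M →ₗ[R] M), (∀ v, (N ^ k) v = 0) →
      ∃ g : M →ₗ[R] M, Function.Injective g ∧ ∀ v, N (g v) = u • g (N v) := by
  induction k with
  | zero =>
    intro M _ _ _ N h
    have h0 : ∀ v : M, v = 0 := fun v => by simpa using h v
    exact ⟨LinearMap.id, fun _ _ h => h, fun v => by rw [h0 v]; simp⟩
  | succ k ih =>
    intro M _ _ _ N h
    let W := LinearMap.range N
    let K := LinearMap.ker N
    have hW : ∀ w ∈ W, N w ∈ W := fun w _ => ⟨w, rfl⟩
    obtain ⟨gW, gWinj, hgW⟩ := ih W (N.restrict hW) (by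
      rintro ⟨_, v, rfl⟩
      apply Subtype.ext
      rw [Module.End.pow_restrict, LinearMap.coe_restrict_apply]
      have := h v
      rw [pow_succ] at this
      exact this)
    have hgW' : ∀ w : W, N (gW w : M) = u • (gW (N.rangeRestrict (w : M)) : M) := fun w => by
      exact congrArg Subtype.val (hgW w)
    obtain ⟨s, hs⟩ := IsSemisimpleModule.lifting_property N.rangeRestrict
      N.surjective_rangeRestrict (LinearMap.id : W →ₗ[R] W)
    have hs' : ∀ w : W, N (s w) = w := fun w => congrArg Subtype.val (LinearMap.congr_fun hs w)
    obtain ⟨C', hC'⟩ := exists_isCompl (K ⊓ W)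
    have hd : Disjoint W (K ⊓ C') := by
      rw [disjoint_iff]
      have := hC'.inf_eq_bot
      rw [eq_bot_iff] at this ⊢
      exact fun x hx => this ⟨⟨hx.2.1, hx.1⟩, hx.2.2⟩
    have hK : ∀ v ∈ K, ∃ w ∈ K ⊓ W, ∃ c ∈ K ⊓ C', w + c = v := by
      intro v hv
      have : v ∈ (K ⊓ W) ⊔ C' := by rw [hC'.sup_eq_top]; trivial
      obtain ⟨w, hw, c, hc, rfl⟩ := Submodule.mem_sup.1 this
      refine ⟨w, hw, c, ⟨?_, hc⟩, rfl⟩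
      have := K.sub_mem hv hw.1
      simpa using this
    obtain ⟨C, hC0, hC1⟩ := hd.symm.exists_isCompl
    have hC := hC1.symm
    obtain ⟨K', hK'⟩ := exists_isCompl K
    let p := W.projectionOnto C hC
    let e := K.projectionOnto K' hK'
    let q : M →ₗ[R] M := LinearMap.id - W.subtype ∘ₗ p
    let g : M →ₗ[R] M := W.subtype ∘ₗ gW ∘ₗ p + u • (s ∘ₗ gW ∘ₗ N.rangeRestrict ∘ₗ q)
      + K.subtype ∘ₗ e ∘ₗ q
    have hg : ∀ v, g v = gW (p v) + u • s (gW (N.rangeRestrict (v - p v))) + e (v - p v) :=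
      fun v => rfl
    have he : ∀ v, N (e v : M) = 0 := fun v => (e v).2
    have hNg : ∀ v, N (g v) = u • (gW (N.rangeRestrict v) : M) := by
      intro v
      rw [hg, map_add, map_add, he, hgW', map_smul, hs']
      rw [map_sub, map_sub, Submodule.coe_sub, smul_sub]
      abel
    have hgw : ∀ w : W, g w = gW w := by
      intro w
      have : p w = w := Submodule.projectionOnto_apply_left hC w
      rw [hg, this]; simp
    refine ⟨g, ?_, ?_⟩
    · rw [injective_iff_map_eq_zero]
      intro v hv
      have h1 := hNg v
      rw [hv, map_zero, eq_comm, hu.smul_eq_zero] at h1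
      have h2 : N.rangeRestrict v = 0 := by
        apply gWinj; rw [map_zero]; exact Subtype.ext h1
      have h3 : v ∈ K := congrArg Subtype.val h2
      obtain ⟨w, hw, c, hc, rfl⟩ := hK v h3
      have hgc : g c = c := by
        have h4 : p c = 0 := Submodule.projectionOnto_apply_of_mem_right hC (hC0 hc)
        have h5 : e c = ⟨c, hc.1⟩ := Submodule.projectionOnto_apply_of_mem_left hK' hc.1
        have h6 : N.rangeRestrict c = 0 := Subtype.ext hc.1
        rw [hg, h4]; simp [h5, h6]
      rw [map_add, hgc, hgw ⟨w, hw.2⟩] at hv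
      have h7 : c ∈ W := by
        rw [← neg_eq_of_add_eq_zero_right hv]
        exact W.neg_mem (gW _).2
      have h8 : c = 0 := (Submodule.disjoint_def.1 hd) c h7 hc
      rw [h8, add_zero] at hv ⊢
      have : (⟨w, hw.2⟩ : W) = 0 := by
        apply gWinj; rw [map_zero]; exact Subtype.ext hv
      exact congrArg Subtype.val this
    · intro v
      rw [hNg]
      congr 1
      exact (hgw (N.rangeRestrict v)).symm

theorem aux_semisimple {n : ℕ} (S : Matrix (Fin n) (Fin n) ℂ)
    (hS : ∃ g : Matrix (Fin n) (Fin n) ℂ, IsUnit g ∧ (g * S * g⁻¹).IsDiag) :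
    Module.End.IsSemisimple (Matrix.toLinAlgEquiv' S) := by
  obtain ⟨g, hg, hD⟩ := hS
  obtain ⟨d, hd⟩ : ∃ d, g * S * g⁻¹ = diagonal d := ⟨_, hD.diagonal_diag.symm⟩
  have hdet := (Matrix.isUnit_iff_isUnit_det g).1 hg
  have hgS : g * S = diagonal d * g := by
    rw [← hd, mul_assoc, Matrix.nonsing_inv_mul _ hdet, mul_one]
  let p : Polynomial ℂ := ∏ a ∈ Finset.univ.image d, (Polynomial.X - Polynomial.C a)
  have hp : Squarefree p := by
    apply Polynomial.Separable.squarefree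
    exact Polynomial.separable_prod_X_sub_C_iff'.2 fun _ _ _ _ h => h
  apply Module.End.isSemisimple_of_squarefree_aeval_eq_zero hp
  rw [← AlgEquiv.coe_toAlgHom, Polynomial.aeval_algHom_apply]
  have key : ∀ r : Polynomial ℂ, g * Polynomial.aeval S r
      = Polynomial.aeval (diagonal d) r * g := by
    intro r
    induction r using Polynomial.induction_on with
    | C a => simp [Algebra.algebraMap_eq_smul_one]
    | add a b ha hb => simp [mul_add, add_mul, ha, hb]
    | monomial k a h =>
      rw [pow_succ, ← mul_assoc, map_mul _ _ Polynomial.X, map_mul _ _ Polynomial.X, ← mul_assoc,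
        h, mul_assoc, Polynomial.aeval_X, hgS, Polynomial.aeval_X, mul_assoc]
  have h0 : Polynomial.aeval (diagonal d) p = 0 := by
    have : diagonal d = Matrix.diagonalAlgHom ℂ d := rfl
    rw [this, Polynomial.aeval_algHom_apply]
    have : Polynomial.aeval d p = 0 := by
      ext i
      rw [Polynomial.aeval_pi_apply]
      simp only [p, Pi.zero_apply, map_prod]
      apply Finset.prod_eq_zero (Finset.mem_image_of_mem d (Finset.mem_univ i))
      simp
    rw [this, map_zero]
  have : Polynomial.aeval S p = 0 := by
    have := key p
    rw [h0, zero_mul] at this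
    exact (hg.mul_right_eq_zero).1 this
  rw [this, map_zero]

theorem aux_conj {n : ℕ} (S N : Matrix (Fin n) (Fin n) ℂ)
    (hS : ∃ g : Matrix (Fin n) (Fin n) ℂ, IsUnit g ∧ (g * S * g⁻¹).IsDiag)
    (hN : IsNilpotent N) (hSN : S * N = N * S) (t : ℂ) (ht : t ≠ 0) :
    ∃ g : Matrix (Fin n) (Fin n) ℂ, IsUnit g ∧ g * (S + N) * g⁻¹ = S + t • N := by
  have hss := aux_semisimple S hS
  let f := Matrix.toLinAlgEquiv' S
  let F := Matrix.toLinAlgEquiv' N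
  let o := Module.AEval'.of f
  have hc : ∀ v, F (f v) = f (F v) := fun v => by
    have : F * f = f * F := by rw [← map_mul, ← map_mul, hSN]
    exact LinearMap.congr_fun this v
  let N' : Module.AEval' f →ₗ[Polynomial ℂ] Module.AEval' f :=
    LinearMap.ofAEval f (o.toLinearMap ∘ₗ F) (fun m => by
      change o (F (f m)) = _
      rw [hc]
      exact (Module.AEval'.X_smul_of f (F m)).symm)
  have hN' : ∀ v, N' (o v) = o (F v) := fun v => rfl
  obtain ⟨k, hk⟩ := hN
  have : IsSemisimpleModule (Polynomial ℂ) (Module.AEval' f) := hss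
  obtain ⟨g, ginj, hg⟩ := aux_scale (Polynomial.C t⁻¹)
    ((isUnit_iff_ne_zero.2 (inv_ne_zero ht)).map Polynomial.C) k (Module.AEval' f) N' (by
      intro v
      have : ∀ j : ℕ, ∀ w, (N' ^ j) (o w) = o ((F ^ j) w) := by
        intro j
        induction j with
        | zero => intro w; rfl
        | succ j ih => intro w; rw [pow_succ, pow_succ, Module.End.mul_apply, hN', ih]; rfl
      obtain ⟨w, rfl⟩ := o.surjective v
      rw [this, ← map_pow, hk]; simp)
  let G : (Fin n → ℂ) →ₗ[ℂ] (Fin n → ℂ) :=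
    o.symm.toLinearMap ∘ₗ g.restrictScalars ℂ ∘ₗ o.toLinearMap
  have hG : ∀ v, o (G v) = g (o v) := fun v => by simp [G]
  have hGinj : Function.Injective G := fun a b h => by
    apply o.injective; apply ginj; rw [← hG, ← hG, h]
  have hGf : G * f = f * G := by
    refine LinearMap.ext fun v => ?_
    apply o.injective
    change o (G (f v)) = o (f (G v))
    rw [hG, ← Module.AEval'.X_smul_of, map_smul, ← hG, Module.AEval'.X_smul_of]
  have hGF : G * F = t • (F * G) := by
    refine LinearMap.ext fun v => ?_
    apply o.injective
    change o (G (F v)) = o (t • F (G v))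
    have h1 : N' (g (o v)) = t⁻¹ • g (N' (o v)) := by
      rw [hg]; exact Module.AEval.C_smul _ _ _
    rw [hN', ← hG, ← hG, hN'] at h1
    rw [map_smul, h1, smul_smul, mul_inv_cancel₀ ht, one_smul]
  have hGu : IsUnit G := by
    rw [LinearMap.isUnit_iff_ker_eq_bot]
    exact LinearMap.ker_eq_bot.2 hGinj
  let e := (Matrix.toLinAlgEquiv' (R := ℂ) (n := Fin n))
  have hu : IsUnit (e.symm G) := hGu.map e.symm
  have hdet := (Matrix.isUnit_iff_isUnit_det _).1 hu
  refine ⟨e.symm G, hu, ?_⟩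
  have h1 : e.symm G * S = S * e.symm G := by
    apply e.injective
    rw [map_mul, map_mul, e.apply_symm_apply]; exact hGf
  have h2 : e.symm G * N = t • (N * e.symm G) := by
    apply e.injective
    rw [map_smul, map_mul, map_mul, e.apply_symm_apply]; exact hGF
  rw [mul_add, h1, h2, ← smul_mul_assoc, ← add_mul, mul_assoc,
    Matrix.mul_nonsing_inv _ hdet, mul_one]

theorem semisimple_and_nilpotent_parts_mem_closure_of_scaled_conjugation_orbit
    (n : ℕ) (A S N : Matrix (Fin n) (Fin n) ℂ)
    (hA : A = S + N)
    (hS : ∃ g : Matrix (Fin n) (Fin n) ℂ, IsUnit g ∧ (g * S * g⁻¹).IsDiag)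
    (hN : IsNilpotent N)
    (hSN : S * N = N * S) :
    S ∈ closure {M : Matrix (Fin n) (Fin n) ℂ |
        ∃ (c : ℝ) (g : Matrix (Fin n) (Fin n) ℂ),
          c ≠ 0 ∧ IsUnit g ∧ M = (c : ℂ) • (g * A * g⁻¹)} ∧
    N ∈ closure {M : Matrix (Fin n) (Fin n) ℂ |
        ∃ (c : ℝ) (g : Matrix (Fin n) (Fin n) ℂ),
          c ≠ 0 ∧ IsUnit g ∧ M = (c : ℂ) • (g * A * g⁻¹)} := by
  subst hA
  constructor
  · have hl : Filter.Tendsto (fun k : ℕ => S + (1 / ((k : ℂ) + 1)) • N) Filter.atTop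
        (nhds (S + (0 : ℂ) • N)) :=
      tendsto_const_nhds.add (tendsto_one_div_add_atTop_nhds_zero_nat.smul_const N)
    rw [zero_smul, add_zero] at hl
    refine mem_closure_of_tendsto hl (Filter.Eventually.of_forall fun k => ?_)
    obtain ⟨g, hg, h⟩ := aux_conj S N hS hN hSN (1 / ((k : ℂ) + 1))
      (one_div_ne_zero (Nat.cast_add_one_ne_zero k))
    exact ⟨1, g, one_ne_zero, hg, by rw [h]; simp⟩
  · have hl : Filter.Tendsto (fun k : ℕ => (1 / ((k : ℂ) + 1)) • S + N) Filter.atTop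
        (nhds ((0 : ℂ) • S + N)) :=
      (tendsto_one_div_add_atTop_nhds_zero_nat.smul_const S).add tendsto_const_nhds
    rw [zero_smul, zero_add] at hl
    refine mem_closure_of_tendsto hl (Filter.Eventually.of_forall fun k => ?_)
    have hk : (k : ℂ) + 1 ≠ 0 := Nat.cast_add_one_ne_zero k
    obtain ⟨g, hg, h⟩ := aux_conj S N hS hN hSN ((k : ℂ) + 1) hk
    refine ⟨1 / ((k : ℝ) + 1), g, one_div_ne_zero (Nat.cast_add_one_ne_zero k), hg, ?_⟩
    rw [h, smul_add, smul_smul]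
    push_cast
    rw [one_div_mul_cancel hk, one_smul]
end
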